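/- There exists a function f : ℝ → ℝ that is discontinuous at every point of ℝ and yet attains every real value on every nondegenerate open interval: for all real a < b and every real y there exists x with a < x < b and f(x) = y. (This realizes Bolzano's idea, in his Theory of Functions §§37–39, of an everywhere discontinuous function that takes every intermediate value.) -/

import Mathlib

open Cardinal in
/-- A subgroup of `ℝ` of cardinality less than the continuum has continuum many cosets. -/
theorem continuum_le_mk_quotient_of_mk_lt (H : AddSubgroup ℝ) (hH : #H < 𝔠) :
    𝔠 ≤ #(ℝ ⧸ H) := by
  by_contra! hQ
  have hprod : 𝔠 = #(ℝ ⧸ H) * #H := by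
    rw [← mk_real, mk_congr (AddSubgroup.addGroupEquivQuotientProdAddSubgroup (s := H)),
      mk_prod, lift_id, lift_id]
  exact (mul_lt_of_lt aleph0_le_continuum hQ hH).ne hprod.symm

open Cardinal in
/-- There is a real function with period every rational number that attains every value. -/
theorem exists_surjective_rat_periodic :
    ∃ f : ℝ → ℝ, Function.Surjective f ∧ ∀ (x : ℝ) (q : ℚ), f (x + q) = f x := by
  let H : AddSubgroup ℝ := (Rat.castHom ℝ).toAddMonoidHom.range
  have hcount : Countable H := (Set.countable_range (Rat.castHom ℝ)).to_subtype
  have hH : #H < 𝔠 := mk_le_aleph0.trans_lt aleph0_lt_continuum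
  obtain ⟨e⟩ : Nonempty (ℝ ↪ ℝ ⧸ H) := by
    rw [← Cardinal.le_def, mk_real]
    exact continuum_le_mk_quotient_of_mk_lt H hH
  refine ⟨fun x => Function.invFun e (x : ℝ ⧸ H),
    (Function.invFun_surjective e.injective).comp (QuotientAddGroup.mk_surjective (s := H)),
    fun x q => ?_⟩
  exact congrArg (Function.invFun e) (QuotientAddGroup.mk_add_of_mem x ⟨q, rfl⟩)

/-- A function attaining every value on every nonempty open interval is nowhere continuous. -/
theorem not_continuousAt_of_surjective_on_intervals {f : ℝ → ℝ}
    (hf : ∀ a b : ℝ, a < b → ∀ y : ℝ, ∃ x, a < x ∧ x < b ∧ f x = y) (c : ℝ) :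
    ¬ ContinuousAt f c := by
  intro h
  obtain ⟨δ, hδ, hball⟩ := Metric.continuousAt_iff.mp h 1 one_pos
  obtain ⟨x, hx₁, hx₂, hx⟩ := hf (c - δ) (c + δ) (by linarith) (f c + 1)
  have hlt := hball (x := x) (by rw [Real.dist_eq, abs_lt]; constructor <;> linarith)
  simp [hx] at hlt

/-- Bolzano's idea: an everywhere discontinuous function attaining every real
value on every nondegenerate open interval. -/
theorem exists_everywhere_discontinuous_surjective_on_intervals :
    ∃ f : ℝ → ℝ,
      (∀ c : ℝ, ¬ ContinuousAt f c) ∧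
      (∀ a b : ℝ, a < b → ∀ y : ℝ, ∃ x, a < x ∧ x < b ∧ f x = y) := by
  obtain ⟨f, hsurj, hper⟩ := exists_surjective_rat_periodic
  have hf : ∀ a b : ℝ, a < b → ∀ y : ℝ, ∃ x, a < x ∧ x < b ∧ f x = y := by
    intro a b hab y
    obtain ⟨x, rfl⟩ := hsurj y
    obtain ⟨q, hq₁, hq₂⟩ := exists_rat_btwn (sub_lt_sub_right hab x)
    exact ⟨x + q, by linarith, by linarith, hper x q⟩
  exact ⟨f, not_continuousAt_of_surjective_on_intervals hf, hf⟩
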